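/- arXiv:1703.06111 — 2 statements merged into one kernel-verified Lean document; each statement's English description precedes it below -/
import Mathlib

section
/- Let k ≥ 2 and n ≥ k+2. Every graph automorphism of the (n,k)-star graph S_{n,k} sends residual edges to residual edges and star edges to star edges. -/
open Equiv

/-- Vertices of the `(n,k)`-star graph: `k`-permutations of an `n`-set, i.e.
ordered `k`-tuples of distinct elements (positions and values are `0`-indexed,
so "position 1" of the paper is the index `j : Fin k` with `j.1 = 0`). -/
def StarVertex (n k : ℕ) : Type :=
  {a : Fin k → Fin n // Function.Injective a}

/-- `u` and `v` are joined by a residual edge: they differ exactly in position 1. -/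
def IsResEdge {n k : ℕ} (u v : StarVertex n k) : Prop :=
  (∀ j : Fin k, j.1 = 0 → u.1 j ≠ v.1 j) ∧ ∀ j : Fin k, j.1 ≠ 0 → u.1 j = v.1 j

/-- `u` and `v` are joined by a star edge: `v` is obtained from `u` by exchanging
the entries in position 1 and position `i` for some position `i ≠ 1`. -/
def IsStarEdge {n k : ℕ} (u v : StarVertex n k) : Prop :=
  ∃ i : Fin k, i.1 ≠ 0 ∧
    (∀ j : Fin k, j.1 = 0 → v.1 j = u.1 i ∧ v.1 i = u.1 j) ∧
    ∀ j : Fin k, j.1 ≠ 0 → j ≠ i → v.1 j = u.1 j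

/-- The `(n,k)`-star graph `S_{n,k}`. -/
def starGraph (n k : ℕ) : SimpleGraph (StarVertex n k) :=
  SimpleGraph.fromRel fun u v => IsStarEdge u v ∨ IsResEdge u v

/-- A (finite) graph is a Cayley graph if it is isomorphic to the Cayley graph of some
finite group `G` with connection set `S ⊆ G` satisfying `1 ∉ S` and `S = S⁻¹`. -/
def IsCayleyGraph {V : Type*} (Γ : SimpleGraph V) : Prop :=
  ∃ (G : Type) (_ : Group G) (_ : Fintype G) (S : Set G),
    (1 : G) ∉ S ∧ (∀ s ∈ S, s⁻¹ ∈ S) ∧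
    Nonempty (Γ ≃g SimpleGraph.fromRel fun g h : G => g⁻¹ * h ∈ S)

/-- The automorphism group of a graph, as a subgroup of the permutation group
of the vertex set. -/
def graphAut {V : Type*} (Γ : SimpleGraph V) : Subgroup (Equiv.Perm V) where
  carrier := {σ | ∀ u w : V, Γ.Adj (σ u) (σ w) ↔ Γ.Adj u w}
  one_mem' := by intro u w; simp
  mul_mem' := by
    intro a b ha hb u w
    rw [Equiv.Perm.mul_apply, Equiv.Perm.mul_apply, ha, hb]
  inv_mem' := by
    intro a ha u w
    simpa using (ha (a⁻¹ u) (a⁻¹ w)).symm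

/-- The copy of `S_{k-1}` inside the symmetric group on the `k` positions:
permutations of the positions `2,…,k` fixing position `1`. (Via the further
identification of positions `2,…,k` with the corresponding points, this is the
subgroup `S_{k-1} ≤ S_n` of the paper.) -/
def SkSub (k : ℕ) : Subgroup (Equiv.Perm (Fin k)) where
  carrier := {ν | ∀ j : Fin k, j.1 = 0 → ν j = j}
  one_mem' := by intro j hj; simp
  mul_mem' := by
    intro a b ha hb j hj
    rw [Equiv.Perm.mul_apply, hb j hj, ha j hj]
  inv_mem' := by
    intro a ha j hj
    have h : a⁻¹ (a j) = j := by simp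
    rwa [ha j hj] at h

/-- The vertex `ē = [1,2,…,k]` of `S_{n,k}`. -/
def eVert (n k : ℕ) (h : k ≤ n) : StarVertex n k :=
  ⟨fun j => ⟨j.1, lt_of_lt_of_le j.2 h⟩, fun a b hab => Fin.ext (by simpa using congrArg Fin.val hab)⟩

/-- The action `φ(μ,ν)` on vertices: `[a_1,…,a_k] ↦ [μ(a_{ν⁻¹(1)}),…,μ(a_{ν⁻¹(k)})]`. -/
def phi (n k : ℕ) (μ : Equiv.Perm (Fin n)) (ν : Equiv.Perm (Fin k))
    (a : StarVertex n k) : StarVertex n k :=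
  ⟨fun j => μ (a.1 (ν⁻¹ j)), fun x y hxy =>
    (Equiv.injective ν⁻¹) (a.2 (Equiv.injective μ hxy))⟩

/-- `φ(μ,ν)` as a permutation of the vertices of `S_{n,k}`. -/
def phiPerm (n k : ℕ) (μ : Equiv.Perm (Fin n)) (ν : Equiv.Perm (Fin k)) :
    Equiv.Perm (StarVertex n k) where
  toFun := phi n k μ ν
  invFun := phi n k μ⁻¹ ν⁻¹
  left_inv a := Subtype.ext (funext fun j => by simp [phi])
  right_inv a := Subtype.ext (funext fun j => by simp [phi])

/-- A subgroup `H ≤ S_n` is `m`-transitive: it acts transitively on the set of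
`m`-permutations (injective `m`-tuples). -/
def IsMultTrans (n m : ℕ) (H : Subgroup (Equiv.Perm (Fin n))) : Prop :=
  ∀ a b : Fin m → Fin n, Function.Injective a → Function.Injective b →
    ∃ μ ∈ H, ∀ j, μ (a j) = b j

/-- A subgroup `H ≤ S_n` is sharply `m`-transitive: it acts regularly on the set of
`m`-permutations (injective `m`-tuples). -/
def IsSharplyMultTrans (n m : ℕ) (H : Subgroup (Equiv.Perm (Fin n))) : Prop :=
  ∀ a b : Fin m → Fin n, Function.Injective a → Function.Injective b →
    ∃! μ : H, ∀ j, (μ : Equiv.Perm (Fin n)) (a j) = b j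

section EdgeTypes

variable {n k : ℕ} {u v w : StarVertex n k}

theorem isResEdge_iff {z : Fin k} (hz : z.1 = 0) :
    IsResEdge u v ↔ u.1 z ≠ v.1 z ∧ ∀ j, j ≠ z → u.1 j = v.1 j := by
  have h : ∀ j : Fin k, j.1 = 0 ↔ j = z := fun j => by rw [Fin.ext_iff, hz]
  simp [IsResEdge, h]

theorem isStarEdge_iff {z : Fin k} (hz : z.1 = 0) :
    IsStarEdge u v ↔ ∃ i, i ≠ z ∧ v.1 z = u.1 i ∧ v.1 i = u.1 z ∧
      ∀ j, j ≠ z → j ≠ i → v.1 j = u.1 j := by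
  have h : ∀ j : Fin k, j.1 = 0 ↔ j = z := fun j => by rw [Fin.ext_iff, hz]
  simp [IsStarEdge, h, and_assoc]

theorem IsResEdge.symm (h : IsResEdge u v) : IsResEdge v u :=
  ⟨fun j hj => (h.1 j hj).symm, fun j hj => (h.2 j hj).symm⟩

theorem IsStarEdge.symm (h : IsStarEdge u v) : IsStarEdge v u := by
  obtain ⟨i, hi, h₁, h₂⟩ := h
  exact ⟨i, hi, fun j hj => ⟨(h₁ j hj).2.symm, (h₁ j hj).1.symm⟩,
    fun j hj hji => (h₂ j hj hji).symm⟩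

theorem starGraph_adj_iff (hk : 0 < k) :
    (starGraph n k).Adj u v ↔ IsStarEdge u v ∨ IsResEdge u v := by
  have hz : (⟨0, hk⟩ : Fin k).1 = 0 := rfl
  rw [starGraph, SimpleGraph.fromRel_adj]
  constructor
  · rintro ⟨-, h | h | h⟩
    exacts [h, .inl h.symm, .inr h.symm]
  · refine fun h => ⟨?_, .inl h⟩
    rintro rfl
    rcases h with h | h
    · obtain ⟨i, hi, h, -⟩ := (isStarEdge_iff hz).1 h
      exact hi (u.2 h).symm
    · exact h.1 _ hz rfl

/-- A star edge and a residual edge at the same vertex do not span a triangle. -/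
theorem IsStarEdge.not_adj_of_isResEdge (hk : 0 < k) (huv : IsStarEdge u v)
    (huw : IsResEdge u w) : ¬ (IsStarEdge v w ∨ IsResEdge v w) := by
  have hz : (⟨0, hk⟩ : Fin k).1 = 0 := rfl
  simp only [isStarEdge_iff hz, isResEdge_iff hz] at huv huw ⊢
  obtain ⟨i, hi, h₁, h₂, h₃⟩ := huv
  have := u.2
  rintro (⟨j, hj, h⟩ | h) <;> grind [Function.Injective]

theorem IsStarEdge.not_isResEdge (hk : 0 < k) (huv : IsStarEdge u v) : ¬ IsResEdge u v := by
  have hz : (⟨0, hk⟩ : Fin k).1 = 0 := rfl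
  simp only [isStarEdge_iff hz, isResEdge_iff hz] at huv ⊢
  obtain ⟨i, hi, h₁, h₂, h₃⟩ := huv
  have := u.2
  grind [Function.Injective]

theorem IsStarEdge.not_isStarEdge_of_isStarEdge (hk : 0 < k) (huv : IsStarEdge u v)
    (huw : IsStarEdge u w) : ¬ IsStarEdge v w := by
  have hz : (⟨0, hk⟩ : Fin k).1 = 0 := rfl
  simp only [isStarEdge_iff hz] at huv huw ⊢
  obtain ⟨i, hi, h₁, h₂, h₃⟩ := huv
  obtain ⟨j, hj, h₄, h₅, h₆⟩ := huw
  have := u.2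
  rintro ⟨l, hl, h⟩
  grind [Function.Injective]

/-- No triangle of the `(n,k)`-star graph contains a star edge. -/
theorem IsStarEdge.not_exists_common_neighbor (hk : 0 < k) (huv : IsStarEdge u v) :
    ¬ ∃ w, (starGraph n k).Adj u w ∧ (starGraph n k).Adj v w := by
  simp only [starGraph_adj_iff hk]
  rintro ⟨w, huw | huw, hvw⟩
  · rcases hvw with hvw | hvw
    · exact huv.not_isStarEdge_of_isStarEdge hk huw hvw
    · exact huv.symm.not_adj_of_isResEdge hk hvw (.inl huw)
  · exact huv.not_adj_of_isResEdge hk huw hvw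

/-- If `n ≥ k + 2`, every residual edge of the `(n,k)`-star graph lies in a triangle. -/
theorem IsResEdge.exists_common_neighbor (hk : 0 < k) (hn : k + 2 ≤ n) (huv : IsResEdge u v) :
    ∃ w, (starGraph n k).Adj u w ∧ (starGraph n k).Adj v w := by
  have hz : (⟨0, hk⟩ : Fin k).1 = 0 := rfl
  generalize (⟨0, hk⟩ : Fin k) = z at hz
  obtain ⟨x, hx⟩ : ∃ x, x ∉ insert (v.1 z) (Finset.univ.image u.1) := by
    by_contra! h
    have h₁ := Finset.card_le_card (fun x _ => h x : Finset.univ ⊆ _)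
    have h₂ := Finset.card_insert_le (v.1 z) (Finset.univ.image u.1)
    have h₃ : (Finset.univ.image u.1).card ≤ _ := Finset.card_image_le
    simp only [Finset.card_univ, Fintype.card_fin] at h₁ h₃
    omega
  simp only [Finset.mem_insert, Finset.mem_image, Finset.mem_univ, true_and, not_or,
    not_exists] at hx
  have hinj : Function.Injective (Function.update u.1 z x) := by
    have := u.2
    intro a b hab
    grind [Function.Injective, Function.update_apply]
  obtain ⟨w, hw⟩ : ∃ w : StarVertex n k, w.1 = Function.update u.1 z x := ⟨⟨_, hinj⟩, rfl⟩
  rw [isResEdge_iff hz] at huv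
  refine ⟨w, (starGraph_adj_iff hk).2 (.inr ((isResEdge_iff hz).2 ?_)),
    (starGraph_adj_iff hk).2 (.inr ((isResEdge_iff hz).2 ?_))⟩ <;> rw [hw] <;>
    grind [Function.update_apply]

theorem IsResEdge.iff_exists_common_neighbor (hk : 0 < k) (hn : k + 2 ≤ n)
    (huv : (starGraph n k).Adj u v) :
    IsResEdge u v ↔ ∃ w, (starGraph n k).Adj u w ∧ (starGraph n k).Adj v w := by
  refine ⟨fun h => h.exists_common_neighbor hk hn, fun h => ?_⟩
  exact ((starGraph_adj_iff hk).1 huv).resolve_left fun h' => h'.not_exists_common_neighbor hk h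

end EdgeTypes

/-- For `k ≥ 2` and `n ≥ k+2`, every automorphism of `S_{n,k}` sends residual edges to
residual edges and star edges to star edges. -/
theorem aut_preserves_edge_types (n k : ℕ) (hk : 2 ≤ k) (hn : k + 2 ≤ n)
    (σ : Equiv.Perm (StarVertex n k)) (hσ : σ ∈ graphAut (starGraph n k))
    (u v : StarVertex n k) :
    (IsResEdge u v → IsResEdge (σ u) (σ v)) ∧
    (IsStarEdge u v → IsStarEdge (σ u) (σ v)) := by
  have hk₀ : 0 < k := by omega
  have hadj : ∀ a b, (starGraph n k).Adj (σ a) (σ b) ↔ (starGraph n k).Adj a b := hσ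
  have hres (h : (starGraph n k).Adj u v) : IsResEdge (σ u) (σ v) ↔ IsResEdge u v := by
    rw [IsResEdge.iff_exists_common_neighbor hk₀ hn h,
      IsResEdge.iff_exists_common_neighbor hk₀ hn ((hadj u v).2 h), ← σ.exists_congr_right]
    simp only [hadj]
  constructor
  · intro h
    exact (hres ((starGraph_adj_iff hk₀).2 (.inr h))).2 h
  · intro h
    have huv := (starGraph_adj_iff hk₀).2 (.inl h)
    exact ((starGraph_adj_iff hk₀).1 ((hadj u v).2 huv)).resolve_right fun h' =>
      h.not_isResEdge hk₀ ((hres huv).1 h')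
end

section
/- For integers k ≥ 2 and n ≥ k+2, the group homomorphism φ: S_n × S_{k−1} → Aut(S_{n,k}) is an isomorphism; in particular the automorphism group of S_{n,k} has order n!·(k−1)!. -/
open Equiv

namespace StarVertex

variable {n k : ℕ}

theorem eq_iff_forall {u v : StarVertex n k} : u = v ↔ ∀ j, u.1 j = v.1 j :=
  ⟨fun h _ => h ▸ rfl, fun h => Subtype.ext (funext h)⟩

theorem inj (u : StarVertex n k) {i j : Fin k} : u.1 i = u.1 j ↔ i = j := u.2.eq_iff

theorem exists_notMem_range (u : StarVertex n k) (hn : k < n) : ∃ x, ∀ j, u.1 j ≠ x := by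
  by_contra! h
  have := Fintype.card_le_of_surjective u.1 h
  simp at this
  omega

theorem exists_notMem_range_ne (u : StarVertex n k) (hn : k + 2 ≤ n) (y : Fin n) :
    ∃ x, x ≠ y ∧ ∀ j, u.1 j ≠ x := by
  by_contra! h
  have hc : (Finset.univ : Finset (Fin n)) ⊆ insert y (Finset.univ.image u.1) := by
    intro x _
    by_cases hx : x = y
    · simp [hx]
    · simpa [hx] using h x hx
  have h1 := Finset.card_le_card hc
  have h2 := Finset.card_insert_le y (Finset.univ.image u.1)
  have h3 := Finset.card_image_le (s := Finset.univ) (f := u.1)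
  simp at h1 h3
  omega

theorem phiPerm_apply (μ : Equiv.Perm (Fin n)) (ν : Equiv.Perm (Fin k)) (u : StarVertex n k)
    (j : Fin k) : (phiPerm n k μ ν u).1 j = μ (u.1 (ν⁻¹ j)) := rfl

theorem phiPerm_mul (μ μ' : Equiv.Perm (Fin n)) (ν ν' : Equiv.Perm (Fin k)) :
    phiPerm n k (μ * μ') (ν * ν') = phiPerm n k μ ν * phiPerm n k μ' ν' := by
  ext1 u
  rw [eq_iff_forall]
  intro j
  simp [phiPerm_apply]

variable [NeZero k]

/-- The vertex obtained by exchanging the entries in the first position and position `i`. -/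
def swapHead (u : StarVertex n k) (i : Fin k) : StarVertex n k :=
  ⟨u.1 ∘ Equiv.swap 0 i, u.2.comp (Equiv.swap 0 i).injective⟩

/-- Two vertices have the same tail if they agree outside the first position. -/
def SameTail (u v : StarVertex n k) : Prop := ∀ j, j ≠ 0 → u.1 j = v.1 j

/-- The tails of two vertices differ in exactly one position. -/
def TailAdj (u v : StarVertex n k) : Prop :=
  ∃ i, i ≠ 0 ∧ u.1 i ≠ v.1 i ∧ ∀ j, j ≠ 0 → j ≠ i → u.1 j = v.1 j

theorem swapHead_apply (u : StarVertex n k) (i j : Fin k) :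
    (u.swapHead i).1 j = u.1 (Equiv.swap 0 i j) := rfl

@[simp] theorem swapHead_zero (u : StarVertex n k) (i : Fin k) :
    (u.swapHead i).1 0 = u.1 i := by simp [swapHead_apply]

@[simp] theorem swapHead_self (u : StarVertex n k) (i : Fin k) :
    (u.swapHead i).1 i = u.1 0 := by simp [swapHead_apply]

theorem swapHead_of_ne (u : StarVertex n k) {i j : Fin k} (hj : j ≠ 0) (hji : j ≠ i) :
    (u.swapHead i).1 j = u.1 j := by
  rw [swapHead_apply, Equiv.swap_apply_of_ne_of_ne hj hji]

@[simp] theorem swapHead_zero_right (u : StarVertex n k) : u.swapHead 0 = u := by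
  rw [eq_iff_forall]; simp [swapHead_apply]

@[simp] theorem swapHead_swapHead (u : StarVertex n k) (i : Fin k) :
    (u.swapHead i).swapHead i = u := by
  rw [eq_iff_forall]; simp [swapHead_apply]

theorem swapHead_injective (u : StarVertex n k) : Function.Injective u.swapHead := by
  intro i j h
  apply u.2
  rw [← swapHead_zero, h, swapHead_zero]

theorem exists_sameTail (u : StarVertex n k) {x : Fin n} (hx : ∀ j, j ≠ 0 → u.1 j ≠ x) :
    ∃ v : StarVertex n k, SameTail v u ∧ v.1 0 = x := by
  refine ⟨⟨Function.update u.1 0 x, ?_⟩, ?_, by simp⟩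
  · intro i j h
    by_cases hi : i = 0 <;> by_cases hj : j = 0 <;> simp_all [Function.update, u.inj]
    exact (hx j hj rfl).elim
  · intro j hj
    simp [hj]

theorem SameTail.symm {u v : StarVertex n k} (h : SameTail u v) : SameTail v u :=
  fun j hj => (h j hj).symm

theorem SameTail.trans {u v w : StarVertex n k} (h : SameTail u v) (h' : SameTail v w) :
    SameTail u w := fun j hj => (h j hj).trans (h' j hj)

theorem SameTail.eq {u v : StarVertex n k} (h : SameTail u v) (h0 : u.1 0 = v.1 0) : u = v :=
  eq_iff_forall.2 fun j => if hj : j = 0 then hj ▸ h0 else h j hj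

theorem isResEdge_iff {u v : StarVertex n k} :
    IsResEdge u v ↔ u ≠ v ∧ SameTail u v := by
  simp only [IsResEdge, Fin.val_eq_zero_iff, ne_eq, forall_eq, SameTail]
  constructor
  · rintro ⟨h, h'⟩
    exact ⟨fun e => h (e ▸ rfl), h'⟩
  · rintro ⟨h, h'⟩
    exact ⟨fun e => h (SameTail.eq h' e), h'⟩

theorem isStarEdge_iff {u v : StarVertex n k} :
    IsStarEdge u v ↔ ∃ i, i ≠ 0 ∧ v = u.swapHead i := by
  simp only [IsStarEdge, Fin.val_eq_zero_iff, ne_eq, forall_eq]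
  refine exists_congr fun i => and_congr_right fun hi => ?_
  constructor
  · rintro ⟨⟨h, h'⟩, h''⟩
    rw [eq_iff_forall]
    intro j
    by_cases hj : j = 0
    · simp [hj, h]
    by_cases hji : j = i
    · simp [hji, h']
    rw [swapHead_of_ne u hj hji, h'' j hj hji]
  · rintro rfl
    exact ⟨by simp, fun j hj hji => swapHead_of_ne u hj hji⟩

theorem adj_iff {u v : StarVertex n k} : (starGraph n k).Adj u v ↔
    (∃ i, i ≠ 0 ∧ v = u.swapHead i) ∨ (u ≠ v ∧ SameTail u v) := by
  simp only [starGraph, SimpleGraph.fromRel_adj, isStarEdge_iff, isResEdge_iff]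
  constructor
  · rintro ⟨h, (⟨h1 | h1⟩ | ⟨i, hi, rfl⟩ | h1)⟩
    · exact Or.inl ‹_›
    · exact Or.inr ‹_›
    · exact Or.inl ⟨i, hi, by simp⟩
    · exact Or.inr ⟨h, h1.2.symm⟩
  · rintro (⟨i, hi, rfl⟩ | h)
    · refine ⟨fun h => hi ?_, Or.inl (Or.inl ⟨i, hi, rfl⟩)⟩
      rw [← u.inj, ← swapHead_zero, ← h]
    · exact ⟨h.1, Or.inl (Or.inr h)⟩

theorem not_common_neighbor {u w : StarVertex n k} {i : Fin k} (hi : i ≠ 0)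
    (huw : (starGraph n k).Adj u w) (hvw : (starGraph n k).Adj (u.swapHead i) w) : False := by
  rw [adj_iff] at huw hvw
  rcases huw with ⟨j, hj, rfl⟩ | ⟨hne, ht⟩ <;> rcases hvw with ⟨l, hl, hw⟩ | ⟨hne', ht'⟩
  · have h0 := eq_iff_forall.1 hw 0
    have h1 := eq_iff_forall.1 hw i
    have h2 := eq_iff_forall.1 hw l
    simp only [swapHead_apply, u.inj] at h0 h1 h2
    grind
  · have h1 := ht' i hi
    simp only [swapHead_apply, u.inj] at h1
    grind
  · subst hw
    apply hne
    have h1 := ht l hl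
    simp only [swapHead_apply, u.inj] at h1
    have : l = i := by grind
    simp [this]
  · have h1 := ht i hi
    have h2 := ht' i hi
    rw [← h2, swapHead_self, u.inj] at h1
    exact hi h1

theorem sameTail_iff (hn : k + 2 ≤ n) {u v : StarVertex n k} : SameTail u v ↔
    u = v ∨ (starGraph n k).Adj u v ∧ ∃ w, (starGraph n k).Adj u w ∧ (starGraph n k).Adj v w := by
  constructor
  · intro h
    by_cases huv : u = v
    · exact Or.inl huv
    refine Or.inr ⟨adj_iff.2 (Or.inr ⟨huv, h⟩), ?_⟩
    obtain ⟨x, hx, hxu⟩ := u.exists_notMem_range_ne hn (v.1 0)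
    obtain ⟨w, hw, rfl⟩ := u.exists_sameTail fun j _ => hxu j
    refine ⟨w, adj_iff.2 (Or.inr ⟨?_, hw.symm⟩), adj_iff.2 (Or.inr ⟨?_, h.symm.trans hw.symm⟩)⟩
    · rintro rfl
      exact hxu 0 rfl
    · rintro rfl
      exact hx rfl
  · rintro (rfl | ⟨huv, w, huw, hvw⟩)
    · exact fun _ _ => rfl
    · rcases adj_iff.1 huv with ⟨i, hi, rfl⟩ | h
      · exact (not_common_neighbor hi huw hvw).elim
      · exact h.2

theorem tailAdj_iff {u v : StarVertex n k} : TailAdj u v ↔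
    ∃ u', SameTail u u' ∧ ∃ i, i ≠ 0 ∧ SameTail (u'.swapHead i) v := by
  constructor
  · rintro ⟨i, hi, hne, h⟩
    obtain ⟨u', hu', h0⟩ := u.exists_sameTail (x := v.1 i) (by
      intro j hj hji
      by_cases e : j = i
      · exact hne (e ▸ hji)
      · exact e (v.2 ((h j hj e).symm.trans hji)))
    refine ⟨u', hu'.symm, i, hi, fun j hj => ?_⟩
    by_cases e : j = i
    · simp [e, h0]
    · rw [swapHead_of_ne _ hj e, hu' j hj, h j hj e]
  · rintro ⟨u', hu', i, hi, h⟩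
    refine ⟨i, hi, ?_, fun j hj hji => ?_⟩
    · rw [← h i hi, hu' i hi, swapHead_self, Ne, u'.inj]
      exact hi
    · rw [← h j hj, hu' j hj, swapHead_of_ne _ hj hji]

theorem map_sameTail {σ : Equiv.Perm (StarVertex n k)}
    (hσ : σ ∈ graphAut (starGraph n k)) (hn : k + 2 ≤ n)
    {u v : StarVertex n k} (h : SameTail u v) :
    SameTail (σ u) (σ v) := by
  rw [sameTail_iff hn] at h ⊢
  rcases h with rfl | ⟨h, w, h1, h2⟩
  · exact Or.inl rfl
  · exact Or.inr ⟨(hσ _ _).2 h, σ w, (hσ _ _).2 h1, (hσ _ _).2 h2⟩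

theorem sameTail_of_map {σ : Equiv.Perm (StarVertex n k)}
    (hσ : σ ∈ graphAut (starGraph n k)) (hn : k + 2 ≤ n)
    {u v : StarVertex n k} (h : SameTail (σ u) (σ v)) :
    SameTail u v := by
  simpa using map_sameTail (inv_mem hσ) hn h

theorem exists_map_swapHead {σ : Equiv.Perm (StarVertex n k)}
    (hσ : σ ∈ graphAut (starGraph n k)) (hn : k + 2 ≤ n)
    (u : StarVertex n k) {i : Fin k} (hi : i ≠ 0) :
    ∃ l, l ≠ 0 ∧ σ (u.swapHead i) = (σ u).swapHead l := by
  have h : (starGraph n k).Adj u (u.swapHead i) := adj_iff.2 (Or.inl ⟨i, hi, rfl⟩)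
  rcases adj_iff.1 ((hσ _ _).2 h) with h' | h'
  · exact h'
  · have := sameTail_of_map hσ hn h'.2 i hi
    rw [swapHead_self, u.inj] at this
    exact (hi this).elim

theorem map_tailAdj {σ : Equiv.Perm (StarVertex n k)}
    (hσ : σ ∈ graphAut (starGraph n k)) (hn : k + 2 ≤ n) {u v : StarVertex n k} (h : TailAdj u v) :
    TailAdj (σ u) (σ v) := by
  rw [tailAdj_iff] at h ⊢
  obtain ⟨u', hu, i, hi, h⟩ := h
  obtain ⟨l, hl, e⟩ := exists_map_swapHead hσ hn u' hi
  exact ⟨σ u', map_sameTail hσ hn hu, l, hl, e ▸ map_sameTail hσ hn h⟩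

/-- `σ` fixes every vertex of the closed neighbourhood of `u`. -/
def FixesNhd (σ : Equiv.Perm (StarVertex n k)) (u : StarVertex n k) : Prop :=
  (∀ w, SameTail w u → σ w = w) ∧ ∀ i, i ≠ 0 → σ (u.swapHead i) = u.swapHead i

theorem FixesNhd.of_sameTail {σ : Equiv.Perm (StarVertex n k)}
    (hσ : σ ∈ graphAut (starGraph n k)) (hn : k + 2 ≤ n) {u v : StarVertex n k} (hu : FixesNhd σ u)
    (h : SameTail v u) : FixesNhd σ v := by
  by_cases hne : v = u
  · exact hne ▸ hu
  have h0 : v.1 0 ≠ u.1 0 := fun e => hne (h.eq e)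
  refine ⟨fun w hw => hu.1 w (hw.trans h), fun i hi => ?_⟩
  have ht : TailAdj (v.swapHead i) (u.swapHead i) := by
    refine ⟨i, hi, by simpa using h0, fun j hj hji => ?_⟩
    rw [swapHead_of_ne _ hj hji, swapHead_of_ne _ hj hji, h j hj]
  obtain ⟨l, hl, e⟩ := exists_map_swapHead hσ hn v hi
  have ht' := map_tailAdj hσ hn ht
  rw [hu.2 i hi, e, hu.1 v h] at ht'
  rw [e, hu.1 v h]
  obtain ⟨m, hm, hmne, hall⟩ := ht'
  by_contra hli
  replace hli : i ≠ l := fun e => hli (by rw [e])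
  have hli' : l ≠ i := hli.symm
  have hi1 : m = i := by
    by_contra hmi
    have := hall i hi (Ne.symm hmi)
    rw [swapHead_self, swapHead_of_ne _ hi hli, h i hi, u.inj] at this
    exact hi this
  have hl1 : m = l := by
    by_contra hml
    have := hall l hl (Ne.symm hml)
    rw [swapHead_self, swapHead_of_ne _ hl hli', ← h l hl, v.inj] at this
    exact hl this.symm
  exact hli (hi1.symm.trans hl1)

/-- A vertex with the tail of `u.swapHead i` is fixed as soon as its head can also be put in front
of the tail of `u`. -/
theorem FixesNhd.map_eq_self {σ : Equiv.Perm (StarVertex n k)}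
    (hσ : σ ∈ graphAut (starGraph n k)) (hn : k + 2 ≤ n) {u f h : StarVertex n k} {i : Fin k}
    (hu : FixesNhd σ u) (hi : i ≠ 0) (hf : SameTail f u) (hh : SameTail h (u.swapHead i))
    (hhf : h.1 0 = f.1 0) : σ h = h := by
  have hf' := hu.of_sameTail hσ hn hf
  have ht : SameTail (h.swapHead i) (f.swapHead i) := by
    intro j hj
    by_cases hji : j = i
    · simp [hji, hhf]
    · rw [swapHead_of_ne _ hj hji, swapHead_of_ne _ hj hji, hf j hj, hh j hj,
        swapHead_of_ne _ hj hji]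
  have hh' : SameTail (σ h) (u.swapHead i) := hu.2 i hi ▸ map_sameTail hσ hn hh
  have ht' := map_sameTail hσ hn ht
  obtain ⟨l, hl, e⟩ := exists_map_swapHead hσ hn h hi
  rw [e, hf'.2 i hi] at ht'
  refine (hh'.trans hh.symm).eq ?_
  have hii := ht' i hi
  rw [swapHead_self] at hii
  by_cases hil : i = l
  · subst hil
    rw [swapHead_self] at hii
    rw [hii, hhf]
  · rw [swapHead_of_ne _ hi hil, hh' i hi, swapHead_self] at hii
    have hll := ht' l hl
    rw [swapHead_self, swapHead_of_ne _ hl (Ne.symm hil), hf l hl] at hll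
    have := (σ h).2.ne hl
    rw [hh' l hl, swapHead_of_ne _ hl (Ne.symm hil)] at this
    exact (this hll.symm).elim

theorem FixesNhd.swapHead {σ : Equiv.Perm (StarVertex n k)}
    (hσ : σ ∈ graphAut (starGraph n k)) (hn : k + 2 ≤ n) {u : StarVertex n k} {i : Fin k}
    (hu : FixesNhd σ u) (hi : i ≠ 0) : FixesNhd σ (u.swapHead i) := by
  have hR : ∀ w, SameTail w (u.swapHead i) → σ w = w := by
    intro w hw
    by_cases hw0 : w.1 0 = u.1 i
    · rw [hw.eq (by simpa using hw0), hu.2 i hi]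
    obtain ⟨f, hf, hf0⟩ := u.exists_sameTail (x := w.1 0) (by
      intro j hj e
      by_cases hji : j = i
      · exact hw0 (hji ▸ e.symm)
      · rw [← swapHead_of_ne u hj hji, ← hw j hj, w.inj] at e
        exact hj e)
    exact hu.map_eq_self hσ hn hi hf hw hf0.symm
  obtain ⟨x, hx⟩ := u.exists_notMem_range (by omega)
  obtain ⟨f, hf, hf0⟩ := u.exists_sameTail fun j _ => hx j
  obtain ⟨h, hh, hh0⟩ := (u.swapHead i).exists_sameTail fun j _ => hx (Equiv.swap 0 i j)
  have hf' := hu.of_sameTail hσ hn hf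
  refine FixesNhd.of_sameTail hσ hn ⟨fun w hw => hR w (hw.trans hh), fun j hj => ?_⟩ hh.symm
  have hhi : h.1 i = u.1 0 := by rw [hh i hi, swapHead_self]
  have hhj : ∀ j, j ≠ 0 → j ≠ i → h.1 j = u.1 j := fun j hj hji => by
    rw [hh j hj, swapHead_of_ne _ hj hji]
  obtain ⟨l, hl, e⟩ := exists_map_swapHead hσ hn h hj
  rw [hR h hh] at e
  rw [e]
  by_cases hji : j = i
  · subst hji
    have ht : SameTail (h.swapHead j) (f.swapHead j) := by
      intro m hm
      by_cases hmj : m = j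
      · simp [hmj, hh0, hf0]
      · rw [swapHead_of_ne _ hm hmj, swapHead_of_ne _ hm hmj, hf m hm, hhj m hm hmj]
    have ht' := map_sameTail hσ hn ht j hj
    rw [e, hf'.2 j hj, swapHead_self, hf0] at ht'
    by_cases hjl : j = l
    · rw [hjl]
    · rw [swapHead_of_ne _ hj hjl, hhi] at ht'
      exact (hx 0 ht').elim
  · have ht : TailAdj (h.swapHead j) (f.swapHead j) := by
      refine ⟨i, hi, ?_, fun m hm hmi => ?_⟩
      · rw [swapHead_of_ne _ hi (Ne.symm hji), swapHead_of_ne _ hi (Ne.symm hji), hhi, hf i hi,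
          Ne, u.inj]
        exact Ne.symm hi
      · by_cases hmj : m = j
        · simp [hmj, hh0, hf0]
        · rw [swapHead_of_ne _ hm hmj, swapHead_of_ne _ hm hmj, hf m hm, hhj m hm hmi]
    have ht' := map_tailAdj hσ hn ht
    rw [e, hf'.2 j hj] at ht'
    obtain ⟨m, hm, hmne, hall⟩ := ht'
    by_contra hlj
    replace hlj : j ≠ l := fun e => hlj (by rw [e])
    have hmj : m = j := by
      by_contra hmj
      have := hall j hj (Ne.symm hmj)
      rw [swapHead_self, swapHead_of_ne _ hj hlj, hf0, hhj j hj hji] at this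
      exact hx j this
    have hmi : m = i := by
      by_contra hmi
      have := hall i hi (Ne.symm hmi)
      rw [swapHead_of_ne f hi (Ne.symm hji), hf i hi] at this
      by_cases hil : i = l
      · rw [← hil, swapHead_self, hh0] at this
        exact hx i this.symm
      · rw [swapHead_of_ne _ hi hil, hhi, u.inj] at this
        exact hi this.symm
    exact hji (hmj.symm.trans hmi)

theorem induction_moves {P : StarVertex n k → Prop}
    (hR : ∀ u v, P u → SameTail v u → P v) (hS : ∀ u i, P u → i ≠ 0 → P (u.swapHead i))
    {u : StarVertex n k} (hu : P u) (w : StarVertex n k) : P w := by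
  have key : ∀ s : Finset (Fin k), 0 ∉ s → ∃ v, P v ∧ ∀ j ∈ s, v.1 j = w.1 j := by
    intro s
    induction s using Finset.induction_on with
    | empty => exact fun _ => ⟨u, hu, by simp⟩
    | insert i s his ih =>
      intro h0
      simp only [Finset.mem_insert, not_or] at h0
      obtain ⟨v, hv, hvs⟩ := ih h0.2
      have hi : i ≠ 0 := Ne.symm h0.1
      have hs : ∀ j ∈ s, j ≠ 0 ∧ j ≠ i :=
        fun j hj => ⟨fun e => h0.2 (e ▸ hj), fun e => his (e ▸ hj)⟩
      obtain ⟨v', hv', h', hvs'⟩ : ∃ v', P v' ∧ v'.1 0 = w.1 i ∧ ∀ j ∈ s, v'.1 j = w.1 j := by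
        by_cases hr : ∃ m, m ≠ 0 ∧ v.1 m = w.1 i
        · obtain ⟨m, hm, e⟩ := hr
          refine ⟨v.swapHead m, hS v m hv hm, by simpa using e, fun j hj => ?_⟩
          rw [swapHead_of_ne _ (hs j hj).1, hvs j hj]
          rintro rfl
          rw [hvs j hj, w.inj] at e
          exact (hs j hj).2 e
        · push Not at hr
          obtain ⟨v', hv', h'⟩ := v.exists_sameTail hr
          exact ⟨v', hR v v' hv hv', h', fun j hj => (hv' j (hs j hj).1).trans (hvs j hj)⟩
      refine ⟨v'.swapHead i, hS v' i hv' hi, fun j hj => ?_⟩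
      rcases Finset.mem_insert.1 hj with rfl | hj
      · simpa using h'
      · rw [swapHead_of_ne _ (hs j hj).1 (hs j hj).2, hvs' j hj]
  obtain ⟨v, hv, h⟩ := key (Finset.univ.erase 0) (by simp)
  exact hR v w hv fun j hj => (h j (by simpa using hj)).symm

theorem FixesNhd.eq_one (hn : k + 2 ≤ n) {σ : Equiv.Perm (StarVertex n k)}
    (hσ : σ ∈ graphAut (starGraph n k)) {u : StarVertex n k} (hu : FixesNhd σ u) : σ = 1 := by
  ext1 w
  exact (induction_moves (P := FixesNhd σ) (fun _ _ h h' => h.of_sameTail hσ hn h')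
    (fun _ _ h hi => h.swapHead hσ hn hi) hu w).1 w fun _ _ => rfl

theorem mem_SkSub_iff {ν : Equiv.Perm (Fin k)} : ν ∈ SkSub k ↔ ν 0 = 0 := by
  change (∀ j : Fin k, j.1 = 0 → ν j = j) ↔ _
  simp

theorem phiPerm_swapHead (μ : Equiv.Perm (Fin n)) {ν : Equiv.Perm (Fin k)} (hν : ν 0 = 0)
    (u : StarVertex n k) (i : Fin k) :
    phiPerm n k μ ν (u.swapHead i) = (phiPerm n k μ ν u).swapHead (ν i) := by
  rw [eq_iff_forall]
  intro j
  have h := Equiv.swap_apply_apply ν 0 i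
  rw [hν] at h
  simp [phiPerm_apply, swapHead_apply, h]

theorem phiPerm_sameTail (μ : Equiv.Perm (Fin n)) {ν : Equiv.Perm (Fin k)} (hν : ν 0 = 0)
    {u v : StarVertex n k} (h : SameTail u v) :
    SameTail (phiPerm n k μ ν u) (phiPerm n k μ ν v) := by
  intro j hj
  rw [phiPerm_apply, phiPerm_apply, h]
  intro e
  rw [Equiv.Perm.inv_eq_iff_eq, hν] at e
  exact hj e

theorem adj_phiPerm (μ : Equiv.Perm (Fin n)) {ν : Equiv.Perm (Fin k)} (hν : ν 0 = 0)
    {u v : StarVertex n k} (h : (starGraph n k).Adj u v) :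
    (starGraph n k).Adj (phiPerm n k μ ν u) (phiPerm n k μ ν v) := by
  rw [adj_iff] at h ⊢
  rcases h with ⟨i, hi, rfl⟩ | ⟨hne, ht⟩
  · exact Or.inl ⟨ν i, fun e => hi (ν.injective (e.trans hν.symm)), phiPerm_swapHead μ hν u i⟩
  · exact Or.inr ⟨(phiPerm n k μ ν).injective.ne hne, phiPerm_sameTail μ hν ht⟩

theorem phiPerm_mem_graphAut (μ : Equiv.Perm (Fin n)) {ν : Equiv.Perm (Fin k)} (hν : ν 0 = 0) :
    phiPerm n k μ ν ∈ graphAut (starGraph n k) := by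
  refine fun u v => ⟨fun h => ?_, adj_phiPerm μ hν⟩
  have h' := adj_phiPerm μ⁻¹ (ν := ν⁻¹) (by rw [Equiv.Perm.inv_eq_iff_eq, hν]) h
  rw [← Equiv.Perm.mul_apply, ← Equiv.Perm.mul_apply, ← phiPerm_mul, inv_mul_cancel,
    inv_mul_cancel] at h'
  exact h'

theorem phiPerm_injective (hn : k < n) {μ μ' : Equiv.Perm (Fin n)} {ν ν' : Equiv.Perm (Fin k)}
    (hν : ν 0 = 0) (hν' : ν' 0 = 0) (h : phiPerm n k μ ν = phiPerm n k μ' ν') :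
    μ = μ' ∧ ν = ν' := by
  have key : ∀ (u : StarVertex n k) j, μ (u.1 (ν⁻¹ j)) = μ' (u.1 (ν'⁻¹ j)) := by
    intro u j
    rw [← phiPerm_apply, h, phiPerm_apply]
  let e := eVert n k hn.le
  have hνν : ν⁻¹ = ν'⁻¹ := by
    ext1 j
    by_contra hne
    by_cases hj : j = 0
    · apply hne
      rw [hj, Equiv.Perm.inv_eq_iff_eq.2 hν.symm, Equiv.Perm.inv_eq_iff_eq.2 hν'.symm]
    have hq : ν'⁻¹ j ≠ 0 := by
      rwa [Ne, Equiv.Perm.inv_eq_iff_eq, hν']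
    obtain ⟨x, hx⟩ := e.exists_notMem_range hn
    obtain ⟨f, hf, rfl⟩ := e.exists_sameTail fun j _ => hx j
    have h1 := key (e.swapHead (ν⁻¹ j)) j
    have h2 := key (f.swapHead (ν⁻¹ j)) j
    rw [swapHead_self, swapHead_of_ne _ hq (Ne.symm hne)] at h1 h2
    rw [hf _ hq, ← h1] at h2
    exact hx 0 (μ.injective h2).symm
  refine ⟨?_, inv_injective hνν⟩
  ext1 x
  obtain ⟨u, j, rfl⟩ : ∃ (u : StarVertex n k) (j : Fin k), u.1 j = x := by
    by_cases hx : ∃ j, e.1 j = x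
    · exact ⟨e, hx⟩
    · push Not at hx
      obtain ⟨f, -, hf⟩ := e.exists_sameTail fun j _ => hx j
      exact ⟨f, 0, hf⟩
  have := key u (ν j)
  simpa [← hνν] using this

theorem exists_phiPerm_eq (hn : k + 2 ≤ n) {σ : Equiv.Perm (StarVertex n k)}
    (hσ : σ ∈ graphAut (starGraph n k)) :
    ∃ (μ : Equiv.Perm (Fin n)) (ν : Equiv.Perm (Fin k)), ν 0 = 0 ∧ phiPerm n k μ ν = σ := by
  let e := eVert n k (by omega)
  have hex : ∀ i : Fin k, ∃ l, (i = 0 → l = 0) ∧ σ (e.swapHead i) = (σ e).swapHead l := by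
    intro i
    by_cases hi : i = 0
    · exact ⟨0, fun _ => rfl, by simp [hi]⟩
    · obtain ⟨l, -, hl⟩ := exists_map_swapHead hσ hn e hi
      exact ⟨l, fun h => (hi h).elim, hl⟩
  choose ν₀ hν₀ hνσ using hex
  have hinj : Function.Injective ν₀ := by
    intro i j hij
    apply e.swapHead_injective
    apply σ.injective
    rw [hνσ, hνσ, hij]
  let ν := Equiv.ofBijective ν₀ (Finite.injective_iff_bijective.1 hinj)
  have hν : ν 0 = 0 := hν₀ 0 rfl
  have hν0 : ∀ j, j ≠ 0 → ν j ≠ 0 := fun j hj h => hj (ν.injective (h.trans hν.symm))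
  have hexμ : ∀ x : Fin n, ∃ y : Fin n, (∀ j, e.1 j = x → y = (σ e).1 (ν j)) ∧
      ∀ w, SameTail w e → w.1 0 = x → y = (σ w).1 0 := by
    intro x
    by_cases hx : ∃ j, e.1 j = x
    · obtain ⟨j, rfl⟩ := hx
      refine ⟨_, fun i hi => by rw [e.2 hi], fun w hw hw0 => ?_⟩
      by_cases hj : j = 0
      · subst hj
        rw [hw.eq hw0, hν]
      · rw [← hw j hj, w.inj] at hw0
        exact (hj hw0.symm).elim
    · push Not at hx
      obtain ⟨w, hw, hw0⟩ := e.exists_sameTail fun j _ => hx j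
      refine ⟨(σ w).1 0, fun j hj => (hx j hj).elim, fun v hv hv0 => ?_⟩
      rw [(hw.trans hv.symm).eq (hw0.trans hv0.symm)]
  choose μ₀ hμ₁ hμ₂ using hexμ
  have hcase : ∀ x : Fin n, (∃ j, j ≠ 0 ∧ e.1 j = x) ∨ ∃ w, SameTail w e ∧ w.1 0 = x := by
    intro x
    by_cases hx : ∃ j, j ≠ 0 ∧ e.1 j = x
    · exact Or.inl hx
    · push Not at hx
      exact Or.inr (e.exists_sameTail hx)
  have hmix : ∀ j w, j ≠ 0 → SameTail w e → (σ e).1 (ν j) ≠ (σ w).1 0 := by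
    intro j w hj hw h
    rw [← map_sameTail hσ hn hw _ (hν0 j hj), (σ w).inj] at h
    exact hν0 j hj h
  have hμinj : Function.Injective μ₀ := by
    intro x y hxy
    rcases hcase x with ⟨i, hi, hx⟩ | ⟨v, hv, hx⟩ <;> rcases hcase y with ⟨j, hj, hy⟩ | ⟨w, hw, hy⟩
    · rw [hμ₁ x i hx, hμ₁ y j hy, (σ e).inj] at hxy
      rw [← hx, ← hy, ν.injective hxy]
    · rw [hμ₁ x i hx, hμ₂ y w hw hy] at hxy
      exact (hmix i w hi hw hxy).elim
    · rw [hμ₂ x v hv hx, hμ₁ y j hy] at hxy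
      exact (hmix j v hj hv hxy.symm).elim
    · rw [hμ₂ x v hv hx, hμ₂ y w hw hy] at hxy
      rw [← hx, ← hy, σ.injective ((map_sameTail hσ hn (hv.trans hw.symm)).eq hxy)]
  let μ := Equiv.ofBijective μ₀ (Finite.injective_iff_bijective.1 hμinj)
  have hφe : phiPerm n k μ ν e = σ e := by
    rw [eq_iff_forall]
    intro j
    rw [phiPerm_apply]
    exact (hμ₁ _ (ν⁻¹ j) rfl).trans (by simp)
  refine ⟨μ, ν, hν, ?_⟩
  have hφ := phiPerm_mem_graphAut μ hν
  rw [← inv_mul_eq_one]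
  refine FixesNhd.eq_one hn (mul_mem (inv_mem hφ) hσ) (u := e) ⟨fun w hw => ?_, fun i hi => ?_⟩
  · rw [Equiv.Perm.mul_apply, Equiv.Perm.inv_eq_iff_eq]
    have ht := phiPerm_sameTail μ hν hw
    rw [hφe] at ht
    refine ((map_sameTail hσ hn hw).trans ht.symm).eq ?_
    rw [phiPerm_apply, Equiv.Perm.inv_eq_iff_eq.2 hν.symm]
    exact (hμ₂ _ w hw rfl).symm
  · rw [Equiv.Perm.mul_apply, Equiv.Perm.inv_eq_iff_eq, phiPerm_swapHead μ hν, hφe]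
    exact hνσ i

theorem card_SkSub : Nat.card (SkSub k) = (k - 1).factorial := by
  have h : Nat.card (SkSub k) = Nat.card (Equiv.Perm {j : Fin k // j ≠ 0}) :=
    Nat.card_congr ((Equiv.subtypeEquivRight fun ν => by simp [mem_SkSub_iff]).trans
      (Equiv.Perm.subtypeEquivSubtypePerm fun j : Fin k => j ≠ 0).symm)
  rw [h, Nat.card_perm, Nat.card_eq_fintype_card, Fintype.card_subtype_compl]
  simp

end StarVertex

/-- For `k ≥ 2` and `n ≥ k+2`, the group homomorphism `φ : S_n × S_{k-1} → Aut(S_{n,k})`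
is an isomorphism (it is a homomorphism into the automorphism group, injective, and
surjective onto the automorphism group); in particular `|Aut(S_{n,k})| = n!·(k-1)!`. -/
theorem aut_star_graph (n k : ℕ) (hk : 2 ≤ k) (hn : k + 2 ≤ n) :
    (∀ (μ : Equiv.Perm (Fin n)) (ν : ↥(SkSub k)),
      phiPerm n k μ ν.1 ∈ graphAut (starGraph n k)) ∧
    (∀ (μ μ' : Equiv.Perm (Fin n)) (ν ν' : ↥(SkSub k)),
      phiPerm n k (μ * μ') (ν * ν').1 = phiPerm n k μ ν.1 * phiPerm n k μ' ν'.1) ∧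
    Function.Injective
      (fun p : Equiv.Perm (Fin n) × ↥(SkSub k) => phiPerm n k p.1 p.2.1) ∧
    (∀ σ ∈ graphAut (starGraph n k), ∃ p : Equiv.Perm (Fin n) × ↥(SkSub k),
      phiPerm n k p.1 p.2.1 = σ) ∧
    Nat.card ↥(graphAut (starGraph n k)) = Nat.factorial n * Nat.factorial (k - 1) := by
  have : NeZero k := ⟨by omega⟩
  have hinj : Function.Injective
      (fun p : Equiv.Perm (Fin n) × ↥(SkSub k) => phiPerm n k p.1 p.2.1) := by
    rintro ⟨μ, ν, hν⟩ ⟨μ', ν', hν'⟩ h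
    obtain ⟨rfl, rfl⟩ :=
      StarVertex.phiPerm_injective (by omega) (StarVertex.mem_SkSub_iff.1 hν)
        (StarVertex.mem_SkSub_iff.1 hν') h
    rfl
  have hmem : ∀ (μ : Equiv.Perm (Fin n)) (ν : ↥(SkSub k)),
      phiPerm n k μ ν.1 ∈ graphAut (starGraph n k) := fun μ ν =>
    StarVertex.phiPerm_mem_graphAut μ (StarVertex.mem_SkSub_iff.1 ν.2)
  have hsurj : ∀ σ ∈ graphAut (starGraph n k), ∃ p : Equiv.Perm (Fin n) × ↥(SkSub k),
      phiPerm n k p.1 p.2.1 = σ := by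
    intro σ hσ
    obtain ⟨μ, ν, hν, h⟩ := StarVertex.exists_phiPerm_eq hn hσ
    exact ⟨(μ, ⟨ν, StarVertex.mem_SkSub_iff.2 hν⟩), h⟩
  refine ⟨hmem, fun μ μ' ν ν' => StarVertex.phiPerm_mul μ μ' ν.1 ν'.1, hinj, hsurj, ?_⟩
  have hbij : Function.Bijective fun p : Equiv.Perm (Fin n) × ↥(SkSub k) =>
      (⟨phiPerm n k p.1 p.2.1, hmem p.1 p.2⟩ : graphAut (starGraph n k)) :=
    ⟨fun p q h => hinj (congrArg Subtype.val h),
      fun σ => (hsurj σ.1 σ.2).imp fun _ h => Subtype.ext h⟩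
  rw [← Nat.card_congr (Equiv.ofBijective _ hbij), Nat.card_prod, Nat.card_perm,
    StarVertex.card_SkSub, Nat.card_fin]
end
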